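/- arXiv:1009.0148 — 2 statements merged into one kernel-verified Lean document; each statement's English description precedes it below -/
import Mathlib

section
/- Let F be an ordinary differential field of characteristic zero and E a differential field extension of F. Let u = (u_1,…,u_r) ∈ E^r and ȳ = (ȳ_1,…,ȳ_n) ∈ E^n be such that u_1,…,u_r are differentially independent over the differential subfield F⟨ȳ_1,…,ȳ_n⟩. Let P_1,…,P_m be differential polynomials over F in the differential variables u_1,…,u_r,y_1,…,y_n, and let P_i(u,ȳ) ∈ E denote the value of P_i obtained by substituting δ^k(u_j) for u_j^{(k)} and δ^k(ȳ_j) for y_j^{(k)}. If P_1(u,ȳ),…,P_m(u,ȳ) are differentially dependent over F⟨u_1,…,u_r⟩, then for every v_1,…,v_r ∈ F, the elements P_1(v,ȳ),…,P_m(v,ȳ) are differentially dependent over F. -/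
/-- A family `a : ι → E` is differentially independent over a subfield `K` of `E`
(w.r.t. a derivation `δ`) if the family of all its iterated derivatives is
algebraically independent over `K`. -/
def DiffIndep {E : Type*} [Field E] (δ : E → E) (K : Subfield E)
    {ι : Type*} (a : ι → E) : Prop :=
  AlgebraicIndependent K (fun p : ι × ℕ => δ^[p.2] (a p.1))

/-- The differential subfield `F⟨S⟩` of `E` generated by `F` and `S`: the subfield
generated by `F` together with all iterated derivatives of elements of `S`. -/
def diffAdjoin {E : Type*} [Field E] (δ : E → E) (F : Subfield E) (S : Set E) : Subfield E :=
  Subfield.closure (↑F ∪ {x | ∃ s ∈ S, ∃ k : ℕ, δ^[k] s = x})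

open MvPolynomial in
/-- If the constant coefficients of a family `Q` of polynomials over `Y` are algebraically
independent over `F`, then `Q` together with the variables is algebraically independent over
`F`. -/
theorem algebraicIndependent_sumElim_X {F Y σ ι : Type*} [CommRing F] [CommRing Y]
    [Algebra F Y] (Q : ι → MvPolynomial σ Y)
    (h : AlgebraicIndependent F (fun i => constantCoeff (Q i))) :
    AlgebraicIndependent F (Sum.elim Q (X : σ → MvPolynomial σ Y)) := by
  have key : ∀ p : MvPolynomial σ (MvPolynomial ι F),
      eval₂ (RingHomClass.toRingHom (aeval Q : _ →ₐ[F] MvPolynomial σ Y)) X p = 0 → p = 0 := by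
    intro p hp
    by_contra hne
    obtain ⟨a, ha, hmin⟩ := p.support.exists_minimal (support_nonempty.mpr hne)
    refine mem_support_iff.mp ha (h ?_)
    have hcoeff := congrArg (coeff a) hp
    rw [eval₂_eq, coeff_sum, Finset.sum_eq_single a] at hcoeff
    · rw [prod_X_pow_eq_monomial, coeff_mul_monomial', if_pos le_rfl, mul_one, tsub_self,
        coeff_zero] at hcoeff
      have hcomp := DFunLike.congr_fun (comp_aeval (R := F) Q
        { (constantCoeff : MvPolynomial σ Y →+* Y) with
          commutes' := fun r => constantCoeff_C σ (algebraMap F Y r) }) (p.coeff a)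
      rw [map_zero]
      exact hcomp.symm.trans hcoeff
    · intro b hb hba
      rw [prod_X_pow_eq_monomial, coeff_mul_monomial', if_neg fun hle => ?_]
      exact hba (le_antisymm hle (hmin hb hle))
    · exact fun h => absurd ha h
  have hswap : AlgebraicIndependent F (Sum.elim (X : σ → MvPolynomial σ Y) Q) := by
    rw [algebraicIndependent_iff]
    intro p hp
    have heval : eval₂ (RingHomClass.toRingHom (aeval Q : _ →ₐ[F] MvPolynomial σ Y)) X
        (sumAlgEquiv F σ ι p) = aeval (Sum.elim X Q) p := by
      clear hp
      induction p using MvPolynomial.induction_on with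
      | C r => simp
      | add p q hp hq => simp [hp, hq]
      | mul_X p i hp => rcases i with i | i <;> simp [hp]
    exact (sumAlgEquiv F σ ι).map_eq_zero_iff.mp (key _ (heval.trans hp))
  convert hswap.comp Sum.swap (Equiv.sumComm ι σ).injective using 1
  ext i : 1
  rcases i with i | i <;> rfl

open MvPolynomial IntermediateField.algebraAdjoinAdjoin in
/-- Let `w` be algebraically independent over `Y`. If the polynomials `Q` over `Y` specialize at
`0` to a family algebraically independent over `F`, then their values at `w` are algebraically
independent over `F(w)`. -/
theorem AlgebraicIndependent.aeval_adjoin {F Y E σ ι : Type*} [Field F] [Field Y] [Field E]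
    [Algebra F Y] [Algebra Y E] [Algebra F E] [IsScalarTower F Y E] {w : σ → E}
    (hw : AlgebraicIndependent Y w) (Q : ι → MvPolynomial σ Y)
    (h : AlgebraicIndependent F (fun i => constantCoeff (Q i))) :
    AlgebraicIndependent (IntermediateField.adjoin F (Set.range w)) (fun i => aeval w (Q i)) := by
  have hsum := (algebraicIndependent_sumElim_X Q h).map' (f := (aeval w).restrictScalars F) hw
  have helim : ((aeval w : MvPolynomial σ Y →ₐ[Y] E).restrictScalars F) ∘ Sum.elim Q X =
      Sum.elim (fun i => aeval w (Q i)) w := by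
    ext i
    rcases i with i | i <;> simp
  rw [helim] at hsum
  exact (AlgebraicIndependent.sumElim_iff.mp hsum).2.extendScalars _

/-- Algebraic independence over a subfield passes to smaller subfields. -/
theorem AlgebraicIndependent.subfield_mono {E ι : Type*} [Field E] {K L : Subfield E}
    (hKL : K ≤ L) {x : ι → E} (h : AlgebraicIndependent L x) : AlgebraicIndependent K x := by
  let _ : Algebra K L := (Subfield.inclusion hKL).toAlgebra
  have : IsScalarTower K L E := IsScalarTower.of_algebraMap_eq' rfl
  exact h.restrictScalars (algebraMap K L).injective

open MvPolynomial in
/-- Algebraic independence is invariant under translation by scalars. -/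
theorem AlgebraicIndependent.sub_algebraMap {R A ι : Type*} [CommRing R] [CommRing A]
    [Algebra R A] {x : ι → A} (hx : AlgebraicIndependent R x) (c : ι → R) :
    AlgebraicIndependent R (fun i => x i - algebraMap R A (c i)) := by
  let φ : MvPolynomial ι R →ₐ[R] MvPolynomial ι R := aeval fun i => X i - C (c i)
  let ψ : MvPolynomial ι R →ₐ[R] MvPolynomial ι R := aeval fun i => X i + C (c i)
  have hφ : Function.Injective φ := by
    refine Function.LeftInverse.injective (g := ψ) fun p => ?_
    have hid : ψ.comp φ = AlgHom.id R _ := by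
      ext i : 1
      simp [φ, ψ, algHom_C, algebraMap_eq]
    exact DFunLike.congr_fun hid p
  have hcomp : aeval (fun i => x i - algebraMap R A (c i)) = (aeval x).comp φ := by
    ext i : 1
    simp [φ]
  rw [AlgebraicIndependent, hcomp]
  exact (show Function.Injective (aeval x) from hx).comp hφ

open MvPolynomial in
/-- The derivative of a differential polynomial is a differential polynomial. -/
theorem exists_aeval_eq_derivative {E : Type*} [Field E] {δ : E → E}
    (hδadd : ∀ a b : E, δ (a + b) = δ a + δ b)
    (hδmul : ∀ a b : E, δ (a * b) = a * δ b + δ a * b)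
    {F : Subfield E} (hF : ∀ x ∈ F, δ x ∈ F) {τ : Type*}
    (p : MvPolynomial (τ × ℕ) F) :
    ∃ q : MvPolynomial (τ × ℕ) F, ∀ a : τ → E,
      δ (aeval (fun s => δ^[s.2] (a s.1)) p) = aeval (fun s => δ^[s.2] (a s.1)) q := by
  induction p using MvPolynomial.induction_on with
  | C c => exact ⟨C ⟨δ c, hF c c.2⟩, fun a => by rw [aeval_C, aeval_C]; rfl⟩
  | add p q hp hq =>
    obtain ⟨p', hp⟩ := hp
    obtain ⟨q', hq⟩ := hq
    exact ⟨p' + q', fun a => by rw [map_add, hδadd, hp, hq, map_add]⟩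
  | mul_X p i hp =>
    obtain ⟨p', hp⟩ := hp
    refine ⟨p * X (i.1, i.2 + 1) + p' * X i, fun a => ?_⟩
    simp only [map_mul, map_add, aeval_X, hδmul, hp, Function.iterate_succ_apply']

open MvPolynomial in
/-- Iterated derivatives of a differential polynomial are differential polynomials. -/
theorem exists_aeval_eq_iterate_derivative {E : Type*} [Field E] {δ : E → E}
    (hδadd : ∀ a b : E, δ (a + b) = δ a + δ b)
    (hδmul : ∀ a b : E, δ (a * b) = a * δ b + δ a * b)
    {F : Subfield E} (hF : ∀ x ∈ F, δ x ∈ F) {τ : Type*}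
    (p : MvPolynomial (τ × ℕ) F) (k : ℕ) :
    ∃ q : MvPolynomial (τ × ℕ) F, ∀ a : τ → E,
      δ^[k] (aeval (fun s => δ^[s.2] (a s.1)) p) = aeval (fun s => δ^[s.2] (a s.1)) q := by
  induction k with
  | zero => exact ⟨p, fun a => rfl⟩
  | succ k ih =>
    obtain ⟨q, hq⟩ := ih
    obtain ⟨q', hq'⟩ := exists_aeval_eq_derivative hδadd hδmul hF q
    exact ⟨q', fun a => by rw [Function.iterate_succ_apply', hq, hq']⟩

/-- **Differential specialization of differential dependence** (Theorem on differential
specializations).  If `u₁,…,u_r ∈ E` are differentially independent over `F⟨ȳ₁,…,ȳₙ⟩`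
and the values `P₁(u,ȳ),…,P_m(u,ȳ)` of differential polynomials over `F` are
differentially dependent over `F⟨u₁,…,u_r⟩`, then for every specialization of the `u`'s
to elements `v₁,…,v_r` of `F`, the values `P₁(v,ȳ),…,P_m(v,ȳ)` are differentially
dependent over `F`. -/
theorem differential_specialization
    {E : Type*} [Field E] [CharZero E] (δ : E → E)
    (hδadd : ∀ a b : E, δ (a + b) = δ a + δ b)
    (hδmul : ∀ a b : E, δ (a * b) = a * δ b + δ a * b)
    (F : Subfield E) (hF : ∀ x ∈ F, δ x ∈ F)
    (r n m : ℕ) (u : Fin r → E) (ybar : Fin n → E)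
    (hu : DiffIndep δ (diffAdjoin δ F (Set.range ybar)) u)
    (P : Fin m → MvPolynomial ((Fin r ⊕ Fin n) × ℕ) F)
    (hdep : ¬ DiffIndep δ (diffAdjoin δ F (Set.range u))
      (fun i => MvPolynomial.aeval (fun p => δ^[p.2] (Sum.elim u ybar p.1)) (P i)))
    (v : Fin r → F) :
    ¬ DiffIndep δ F
      (fun i => MvPolynomial.aeval
        (fun p => δ^[p.2] (Sum.elim (fun j => (v j : E)) ybar p.1)) (P i)) := by
  intro hind
  apply hdep
  set Y := diffAdjoin δ F (Set.range ybar)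
  have hFY : F ≤ Y := fun x hx => Subfield.subset_closure (Or.inl hx)
  have hyY (j : Fin n) (k : ℕ) : δ^[k] (ybar j) ∈ Y :=
    Subfield.subset_closure (Or.inr ⟨_, ⟨j, rfl⟩, k, rfl⟩)
  let _ : Algebra F Y := (Subfield.inclusion hFY).toAlgebra
  have : IsScalarTower F Y E := IsScalarTower.of_algebraMap_eq' rfl
  have hvF (p : Fin r × ℕ) : δ^[p.2] (v p.1 : E) ∈ F :=
    Set.MapsTo.iterate (f := δ) (s := (F : Set E)) hF p.2 (v p.1).2
  let c : Fin r × ℕ → Y := fun p => ⟨_, hFY (hvF p)⟩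
  let w : Fin r × ℕ → E := fun p => δ^[p.2] (u p.1) - algebraMap Y E (c p)
  have hw : AlgebraicIndependent Y w := AlgebraicIndependent.sub_algebraMap hu c
  choose G hG using fun p : Fin m × ℕ =>
    exists_aeval_eq_iterate_derivative hδadd hδmul hF (P p.1) p.2
  let s : (Fin r ⊕ Fin n) × ℕ → MvPolynomial (Fin r × ℕ) Y := fun p =>
    Sum.elim (fun j => MvPolynomial.X (j, p.2) + MvPolynomial.C (c (j, p.2)))
      (fun j => MvPolynomial.C ⟨_, hyY j p.2⟩) p.1
  have hsu (p) : MvPolynomial.aeval w (MvPolynomial.aeval s (G p)) =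
      δ^[p.2] (MvPolynomial.aeval (fun q => δ^[q.2] (Sum.elim u ybar q.1)) (P p.1)) := by
    rw [hG p (Sum.elim u ybar), ← AlgHom.restrictScalars_apply F,
      ← AlgHom.comp_apply, MvPolynomial.comp_aeval]
    congr 2
    ext ⟨q | q, k⟩
    · simp [s, w, c]
    · simp [s, w, c]
      rfl
  have hsv (p) : algebraMap Y E (MvPolynomial.constantCoeff (MvPolynomial.aeval s (G p))) =
      δ^[p.2] (MvPolynomial.aeval
        (fun q => δ^[q.2] (Sum.elim (fun j => (v j : E)) ybar q.1)) (P p.1)) := by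
    rw [hG p (Sum.elim (fun j => (v j : E)) ybar),
      ← MvPolynomial.aeval_zero, ← AlgHom.restrictScalars_apply F,
      ← AlgHom.comp_apply, MvPolynomial.comp_aeval]
    congr 2
    ext ⟨q | q, k⟩
    · simp [s, c]
      rfl
    · simp [s, c]
      rfl
  have hQ : AlgebraicIndependent F
      (fun p => MvPolynomial.constantCoeff (MvPolynomial.aeval s (G p))) := by
    refine AlgebraicIndependent.of_comp (IsScalarTower.toAlgHom F Y E) ?_
    rw [DiffIndep, ← funext hsv] at hind
    exact hind
  have hmain := hw.aeval_adjoin _ hQ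
  simp only [hsu] at hmain
  refine AlgebraicIndependent.subfield_mono
    (L := (IntermediateField.adjoin F (Set.range w)).toSubfield) ?_ hmain
  refine Subfield.closure_le.mpr (Set.union_subset ?_ ?_)
  · exact fun x hx => (IntermediateField.adjoin F (Set.range w)).algebraMap_mem ⟨x, hx⟩
  · rintro _ ⟨_, ⟨j, rfl⟩, k, rfl⟩
    have hwmem : w (j, k) ∈ IntermediateField.adjoin F (Set.range w) :=
      IntermediateField.subset_adjoin F _ ⟨(j, k), rfl⟩
    have hvmem := (IntermediateField.adjoin F (Set.range w)).algebraMap_mem ⟨_, hvF (j, k)⟩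
    have hsum := add_mem hwmem hvmem
    rwa [show w (j, k) + algebraMap F E ⟨_, hvF (j, k)⟩ = δ^[k] (u j) from
      sub_add_cancel _ _] at hsum
end

section
/- Let F be an ordinary differential field of characteristic zero and E a differential field extension of F. Let d ≥ 1 and let ξ = (ξ_1,…,ξ_n) ∈ E^n (n ≥ d) with ξ_1,…,ξ_d differentially independent over F. Fix natural numbers s ≥ 0 and m ≥ 1, let M be the set of all exponent vectors α = (α_{jk})_{1≤j≤n, 0≤k≤s} of nonnegative integers with 1 ≤ |α| ≤ m, and write ξ^α = Π_{j=1}^n Π_{k=0}^s (δ^k ξ_j)^{α_{jk}}. Let (u_α)_{α∈M} be a family of elements of E that is differentially independent over F⟨ξ_1,…,ξ_n⟩, and set ζ_0 = −Σ_{α∈M} u_α ξ^α. Then the d elements ξ_1, …, ξ_{d−1}, ζ_0 are differentially independent over the differential subfield F⟨u_α : α ∈ M⟩. (This is the dimension-reduction step showing that intersecting an irreducible differential variety of dimension d with a generic differential hypersurface yields dimension d−1.) -/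
set_option synthInstance.maxHeartbeats 1000000
set_option maxHeartbeats 1000000

/-- The set of exponent vectors `α = (α_{jk})_{1≤j≤n, 0≤k≤s}` of nonnegative integers
with `1 ≤ |α| ≤ m`. -/
abbrev GenMon (n s m : ℕ) : Type :=
  {α : Fin n × Fin (s + 1) → Fin (m + 1) //
    1 ≤ ∑ p : Fin n × Fin (s + 1), ((α p : ℕ)) ∧ ∑ p : Fin n × Fin (s + 1), ((α p : ℕ)) ≤ m}

/-- The monomial value `ξ^α = ∏_{j,k} (δᵏ ξⱼ)^{α_{jk}}`. -/
noncomputable def monValue {E : Type*} [Field E] (δ : E → E) {n : ℕ} (s m : ℕ)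
    (ξ : Fin n → E) (α : GenMon n s m) : E :=
  ∏ p : Fin n × Fin (s + 1), (δ^[(p.2 : ℕ)] (ξ p.1)) ^ ((α.1 p : ℕ))

namespace MvPolynomial

/-- A ring homomorphism into `B[σ]` that stays injective after setting all variables to zero
extends to an injective homomorphism on `A[σ]` fixing the variables. -/
theorem eval₂Hom_X_injective {σ A B : Type*} [CommRing A] [CommRing B]
    (f : A →+* MvPolynomial σ B) (hf : Function.Injective (constantCoeff.comp f)) :
    Function.Injective (eval₂Hom f (X : σ → MvPolynomial σ B)) := by
  classical
  rw [injective_iff_map_eq_zero]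
  intro p hp
  by_contra hne
  obtain ⟨μ, hμ, hmin⟩ := p.support.finite_toSet.exists_minimal
    (Finset.coe_nonempty.2 (support_nonempty.2 hne))
  refine mem_support_iff.1 hμ (hf ?_)
  have h := congrArg (coeff μ) hp
  simp only [coe_eval₂Hom, eval₂_eq, coeff_zero, coeff_sum] at h
  have hmon (ν : σ →₀ ℕ) : ∏ i ∈ ν.support, (X i : MvPolynomial σ B) ^ ν i = monomial ν 1 := by
    rw [monomial_eq, C_1, one_mul, Finsupp.prod]
  rw [Finset.sum_eq_single_of_mem μ hμ] at h
  · rw [hmon, coeff_mul_monomial', if_pos le_rfl, tsub_self, mul_one] at h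
    simpa [constantCoeff_eq] using h
  · intro ν hν hνμ
    rw [hmon, coeff_mul_monomial', if_neg fun hle => hνμ (le_antisymm hle (hmin hν hle))]

end MvPolynomial

namespace AlgebraicIndependent

open MvPolynomial

theorem add_algebraMap {σ R A : Type*} [CommRing R] [CommRing A] [Algebra R A] {y : σ → A}
    (hy : AlgebraicIndependent R y) (c : σ → R) :
    AlgebraicIndependent R (fun i => y i + algebraMap R A (c i)) := by
  have hcomp : aeval (R := R) (fun i => y i + algebraMap R A (c i)) =
      (aeval y).comp (aeval fun i => (X i + C (c i) : MvPolynomial σ R)) := by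
    ext i; simp
  rw [algebraicIndependent_iff_injective_aeval, hcomp, AlgHom.coe_comp]
  refine Function.Injective.comp hy (Function.LeftInverse.injective
    (g := aeval fun i => (X i - C (c i) : MvPolynomial σ R)) fun p => ?_)
  have hid : (aeval fun i => (X i - C (c i) : MvPolynomial σ R)).comp
      (aeval fun i => (X i + C (c i) : MvPolynomial σ R)) = AlgHom.id R _ := by
    ext i; simp [← algebraMap_eq]
  exact DFunLike.congr_fun hid p

/-- If the constant terms of the polynomials `W t` are algebraically independent over `F`, then
the values `W t (y)` at a family `y` algebraically independent over `G ⊇ F` are, jointly with `y`,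
algebraically independent over `F`. -/
theorem sumElim_aeval {σ τ F G E : Type*} [CommRing F] [CommRing G] [CommRing E]
    [Algebra F G] [Algebra G E] [Algebra F E] [IsScalarTower F G E] {y : σ → E}
    (hy : AlgebraicIndependent G y) (W : τ → MvPolynomial σ G)
    (hW : AlgebraicIndependent F fun t => constantCoeff (W t)) :
    AlgebraicIndependent F (Sum.elim y fun t => aeval y (W t)) := by
  have hinj := eval₂Hom_X_injective (σ := σ) (aeval (R := F) W).toRingHom <| by
    have h0 : (constantCoeff.comp (aeval (R := F) W).toRingHom : MvPolynomial τ F →+* G) =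
        (aeval fun t => constantCoeff (W t)).toRingHom := by
      ext <;> simp [IsScalarTower.algebraMap_apply F G (MvPolynomial σ G), algebraMap_eq]
    rw [h0]
    exact hW
  have hcomp : (aeval (R := F) (Sum.elim y fun t => aeval y (W t))).toRingHom =
      ((aeval y).toRingHom.comp (eval₂Hom (aeval (R := F) W).toRingHom X)).comp
        (sumAlgEquiv F σ τ).toAlgHom.toRingHom := by
    refine ringHom_ext (fun a => ?_) fun i => ?_
    · simp [IsScalarTower.algebraMap_apply F G E,
        IsScalarTower.algebraMap_apply F G (MvPolynomial σ G), algebraMap_eq]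
    · rcases i with i | i <;> simp
  rw [algebraicIndependent_iff_injective_aeval]
  have h := (Function.Injective.comp hy hinj).comp (sumAlgEquiv F σ τ).injective
  convert! h using 1
  exact congrArg DFunLike.coe hcomp

open scoped IntermediateField.algebraAdjoinAdjoin in
/-- Algebraic independence over a ring generated by `y` passes to any subfield of the field it
generates. -/
theorem of_sumElim_of_le_closure {σ τ E : Type*} [Field E] {F K : Subfield E}
    {y : σ → E} {z : τ → E} (h : AlgebraicIndependent F (Sum.elim y z))
    (hK : K ≤ Subfield.closure (F ∪ Set.range y)) : AlgebraicIndependent K z := by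
  have hswap : AlgebraicIndependent F (Sum.elim z y) := by
    convert! h.comp Sum.swap Sum.swap_leftInverse.injective using 1
    ext (_ | _) <;> rfl
  let L := IntermediateField.adjoin F (Set.range y)
  have hL : AlgebraicIndependent L z := (sumElim_iff.1 hswap).2.extendScalars L
  have hKL : K ≤ L.toSubfield := by
    refine hK.trans (Subfield.closure_mono (Set.union_subset_union_left _ ?_))
    exact fun x hx => ⟨⟨x, hx⟩, rfl⟩
  let _ : Algebra K L := (Subfield.inclusion hKL).toAlgebra
  have : IsScalarTower K L E := .of_algebraMap_eq fun _ => rfl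
  exact hL.restrictScalars (algebraMap K L).injective

end AlgebraicIndependent

section Differential

variable {E : Type*} [Field E] {δ : E → E}

theorem iterate_add_of_additive (hadd : ∀ a b : E, δ (a + b) = δ a + δ b) (k : ℕ) (a b : E) :
    δ^[k] (a + b) = δ^[k] a + δ^[k] b := by
  induction k generalizing a b with
  | zero => rfl
  | succ k ih => simp only [Function.iterate_succ_apply, hadd, ih]

theorem iterate_mem_of_forall_mem {K : Subfield E} (hK : ∀ x ∈ K, δ x ∈ K) (k : ℕ) {x : E}
    (hx : x ∈ K) : δ^[k] x ∈ K := by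
  induction k generalizing x with
  | zero => exact hx
  | succ k ih => exact ih (hK x hx)

theorem le_diffAdjoin (F : Subfield E) (S : Set E) : F ≤ diffAdjoin δ F S :=
  fun _ hx => Subfield.subset_closure (Or.inl hx)

theorem iterate_mem_diffAdjoin (F : Subfield E) {S : Set E} {x : E} (hx : x ∈ S) (k : ℕ) :
    δ^[k] x ∈ diffAdjoin δ F S :=
  Subfield.subset_closure (Or.inr ⟨x, hx, k, rfl⟩)

theorem derivation_mem_diffAdjoin (hadd : ∀ a b : E, δ (a + b) = δ a + δ b)
    (hmul : ∀ a b : E, δ (a * b) = a * δ b + δ a * b) {F : Subfield E}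
    (hF : ∀ x ∈ F, δ x ∈ F) (S : Set E) {x : E} (hx : x ∈ diffAdjoin δ F S) :
    δ x ∈ diffAdjoin δ F S := by
  have h0 : δ 0 = 0 := by simpa using hadd 0 0
  have h1 : δ 1 = 0 := by simpa using hmul 1 1
  unfold diffAdjoin at hx
  induction hx using Subfield.closure_induction with
  | mem x hx =>
    rcases hx with hx | ⟨s, hs, k, rfl⟩
    · exact le_diffAdjoin F S (hF x hx)
    · rw [← Function.iterate_succ_apply' δ]
      exact iterate_mem_diffAdjoin F hs _
  | one => rw [h1]; exact zero_mem _
  | add x y _ _ hx hy => rw [hadd]; exact add_mem hx hy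
  | neg x _ hx =>
    have : δ (-x) = -δ x := by
      rw [eq_neg_iff_add_eq_zero, ← hadd, neg_add_cancel, h0]
    rw [this]; exact neg_mem hx
  | inv x hxS hx =>
    rcases eq_or_ne x 0 with rfl | hne
    · rwa [inv_zero]
    · have h := hmul x x⁻¹
      rw [mul_inv_cancel₀ hne, h1] at h
      have : δ x⁻¹ = -(x⁻¹ * (δ x * x⁻¹)) := by
        field_simp at h ⊢
        linear_combination -h
      rw [this]
      exact neg_mem (mul_mem (inv_mem hxS) (mul_mem hx (inv_mem hxS)))
  | mul x y hxS hyS hx hy => rw [hmul]; exact add_mem (mul_mem hxS hy) (mul_mem hx hyS)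

open MvPolynomial in
/-- The derivation of `E` lifts along the evaluation of differential polynomials in such a way
that it commutes with setting all variables to zero. -/
theorem exists_aeval_eq_derivation (hadd : ∀ a b : E, δ (a + b) = δ a + δ b)
    (hmul : ∀ a b : E, δ (a * b) = a * δ b + δ a * b) {G : Subfield E}
    (hG : ∀ x ∈ G, δ x ∈ G) {ι : Type*} (v : ι → E) (p : MvPolynomial (ι × ℕ) G) :
    ∃ q : MvPolynomial (ι × ℕ) G,
      aeval (fun i : ι × ℕ => δ^[i.2] (v i.1)) q =
        δ (aeval (fun i : ι × ℕ => δ^[i.2] (v i.1)) p) ∧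
      ((constantCoeff q : G) : E) = δ ((constantCoeff p : G) : E) := by
  have h0 : δ 0 = 0 := by simpa using hadd 0 0
  have hval (x : G) : algebraMap G E x = x := rfl
  induction p using MvPolynomial.induction_on with
  | C a => exact ⟨C ⟨δ a, hG a a.2⟩, by simp [hval], by simp⟩
  | add p q hp hq =>
    obtain ⟨p', hp, hp0⟩ := hp
    obtain ⟨q', hq, hq0⟩ := hq
    exact ⟨p' + q', by simp [hp, hq, hadd], by simp [hp0, hq0, hadd]⟩
  | mul_X p i hp =>
    obtain ⟨p', hp, hp0⟩ := hp
    refine ⟨p * X (i.1, i.2 + 1) + p' * X i, ?_, by simp [h0]⟩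
    simp [hp, hmul, Function.iterate_succ_apply']

end Differential

/-- **Dimension reduction by a generic differential hypersurface.**  Let `d = e + 1 ≥ 1`,
`ξ₁,…,ξ_d` differentially independent over `F`, `(u_α)` differentially independent
over `F⟨ξ₁,…,ξₙ⟩`, and `ζ₀ = −∑_α u_α ξ^α`.  Then the `d` elements
`ξ₁,…,ξ_{d−1}, ζ₀` are differentially independent over `F⟨u_α : α ∈ M⟩`. -/
theorem dimension_reduction_generic_hypersurface
    {E : Type*} [Field E] [CharZero E] (δ : E → E)
    (hδadd : ∀ a b : E, δ (a + b) = δ a + δ b)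
    (hδmul : ∀ a b : E, δ (a * b) = a * δ b + δ a * b)
    (F : Subfield E) (hF : ∀ x ∈ F, δ x ∈ F)
    (n e s m : ℕ) (hm : 1 ≤ m) (hn : e + 1 ≤ n) (ξ : Fin n → E)
    (hξ : DiffIndep δ F (fun i : Fin (e + 1) => ξ ⟨(i : ℕ), by omega⟩))
    (u : GenMon n s m → E)
    (hu : DiffIndep δ (diffAdjoin δ F (Set.range ξ)) u)
    (ζ0 : E) (hζ0 : ζ0 = -∑ α : GenMon n s m, u α * monValue δ s m ξ α) :
    DiffIndep δ (diffAdjoin δ F (Set.range u))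
      (Fin.snoc (fun i : Fin e => ξ ⟨(i : ℕ), by omega⟩) ζ0) := by
  classical
  set G := diffAdjoin δ F (Set.range ξ)
  have hFG : F ≤ G := le_diffAdjoin F _
  have hG : ∀ x ∈ G, δ x ∈ G := fun x hx => derivation_mem_diffAdjoin hδadd hδmul hF _ hx
  have hξG (j : Fin n) (k : ℕ) : δ^[k] (ξ j) ∈ G :=
    iterate_mem_diffAdjoin F (Set.mem_range_self j) k
  let p₀ : Fin n × Fin (s + 1) := (⟨e, by omega⟩, 0)
  let α₀ : GenMon n s m :=
    ⟨fun p => if p = p₀ then ⟨1, by omega⟩ else 0, by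
      simp [apply_ite (Fin.val : Fin (m + 1) → ℕ), hm]⟩
  have hmon₀ : monValue δ s m ξ α₀ = ξ ⟨e, by omega⟩ := by
    rw [monValue, Finset.prod_eq_single p₀]
    · simp [α₀, p₀]
    · intro p _ hp
      simp [α₀, hp]
    · simp
  have hmonG (α : GenMon n s m) : monValue δ s m ξ α ∈ G :=
    prod_mem fun p _ => pow_mem (hξG _ _) _
  let c : GenMon n s m → E := fun α => if α = α₀ then 1 else 0
  have hcF (α : GenMon n s m) (k : ℕ) : δ^[k] (c α) ∈ F := by
    refine iterate_mem_of_forall_mem hF k ?_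
    simp only [c]; split_ifs
    exacts [one_mem F, zero_mem F]
  let v : GenMon n s m → E := fun α => u α + c α
  let y : GenMon n s m × ℕ → E := fun p => δ^[p.2] (v p.1)
  have hyu (p : GenMon n s m × ℕ) : y p = δ^[p.2] (u p.1) + δ^[p.2] (c p.1) :=
    iterate_add_of_additive hδadd _ _ _
  have hy : AlgebraicIndependent G y := by
    have hsum : y = fun p => δ^[p.2] (u p.1) +
        algebraMap G E ⟨δ^[p.2] (c p.1), hFG (hcF p.1 p.2)⟩ := funext hyu
    rw [hsum]
    exact AlgebraicIndependent.add_algebraMap hu _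
  let z : Fin (e + 1) → E := Fin.snoc (fun i : Fin e => ξ ⟨(i : ℕ), by omega⟩) ζ0
  have hval (x : G) : algebraMap G E x = x := rfl
  have hzero (i : Fin (e + 1)) : ∃ q : MvPolynomial (GenMon n s m × ℕ) G,
      MvPolynomial.aeval y q = z i ∧
        ((MvPolynomial.constantCoeff q : G) : E) = ξ ⟨(i : ℕ), by omega⟩ := by
    induction i using Fin.lastCases with
    | cast i => exact ⟨.C ⟨_, hξG ⟨i, by omega⟩ 0⟩, by simp [z, hval], by simp⟩
    | last =>
      refine ⟨.C ⟨_, hξG ⟨e, by omega⟩ 0⟩ -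
        ∑ α, .X (α, 0) * .C (⟨monValue δ s m ξ α, hmonG α⟩ : G), ?_, by simp⟩
      have hc : ∑ α, c α * monValue δ s m ξ α = ξ ⟨e, by omega⟩ := by simp [c, hmon₀]
      simp [z, y, v, hζ0, add_mul, Finset.sum_add_distrib, hc, hval]
  have hW (t : Fin (e + 1) × ℕ) : ∃ q : MvPolynomial (GenMon n s m × ℕ) G,
      MvPolynomial.aeval y q = δ^[t.2] (z t.1) ∧
        ((MvPolynomial.constantCoeff q : G) : E) = δ^[t.2] (ξ ⟨(t.1 : ℕ), by omega⟩) := by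
    obtain ⟨i, k⟩ := t
    induction k with
    | zero => exact hzero i
    | succ k ih =>
      obtain ⟨q, hq, hq0⟩ := ih
      obtain ⟨q', hq', hq0'⟩ := exists_aeval_eq_derivation hδadd hδmul hG v q
      refine ⟨q', ?_, ?_⟩
      · rw [Function.iterate_succ_apply', ← hq]; exact hq'
      · rw [Function.iterate_succ_apply', ← hq0]; exact hq0'
  choose W hWz hWξ using hW
  let _ : Algebra F G := (Subfield.inclusion hFG).toAlgebra
  have : IsScalarTower F G E := .of_algebraMap_eq fun _ => rfl
  have hW0 : AlgebraicIndependent F fun t => MvPolynomial.constantCoeff (W t) := by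
    refine AlgebraicIndependent.of_comp (IsScalarTower.toAlgHom F G E) ?_
    have hcomp : IsScalarTower.toAlgHom F G E ∘ (fun t => MvPolynomial.constantCoeff (W t)) =
        fun t => δ^[t.2] (ξ ⟨(t.1 : ℕ), by omega⟩) := funext hWξ
    rw [hcomp]
    exact hξ
  have h := hy.sumElim_aeval W hW0
  simp only [hWz] at h
  refine h.of_sumElim_of_le_closure (Subfield.closure_le.2 ?_)
  rintro x (hx | ⟨_, ⟨α, rfl⟩, k, rfl⟩)
  · exact Subfield.subset_closure (Or.inl hx)
  · have hx : δ^[k] (u α) = y (α, k) - δ^[k] (c α) := by rw [hyu]; ring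
    rw [hx]
    exact sub_mem (Subfield.subset_closure (Or.inr ⟨_, rfl⟩))
      (Subfield.subset_closure (Or.inl (hcF α k)))
end
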